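/- For every m ∈ ℝ, ν ≥ 0 and integers N, n ≥ 0 there exists C > 0 such that the following holds for every R ≥ 1. Let a : ℝ×ℝ → ℂ, (x,ξ) ↦ a(x,ξ), be 2π-periodic in x, with all partial derivatives ∂_x^β₁∂_ξ^β₂ a for β₁ ≤ N, β₂ ≤ n existing and continuous, and let M > 0 be such that |∂_x^{β₁}∂_ξ^{β₂} a(x,ξ)| ≤ M·max(1,|ξ|)^{m−β₂} for all β₁ ≤ N, β₂ ≤ n and all (x,ξ). Then the cut-offed symbol a_R(x,ξ) := a(x,ξ)·η_R(ξ) satisfies |∂_x^{β₁}∂_ξ^{β₂} a_R(x,ξ)| ≤ C·M·R^{−ν}·max(1,|ξ|)^{m+ν−β₂} for all β₁ ≤ N, β₂ ≤ n and all (x,ξ). -/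

import Mathlib

noncomputable section

/-- The smooth cut-off `η`: `0` for `y ≤ 1`,
`e^{-1/(y-1)} / (e^{-1/(y-1)} + e^{-1/(2-y)})` for `1 < y < 2`, and `1` for `y ≥ 2`. -/
def etaCut (y : ℝ) : ℝ :=
  if y ≤ 1 then 0
  else if y < 2 then
    Real.exp (-(1 / (y - 1))) / (Real.exp (-(1 / (y - 1))) + Real.exp (-(1 / (2 - y))))
  else 1

/-- The mixed partial derivative `∂_x^{β₁} ∂_ξ^{β₂} a (x,ξ)` of a symbol. -/
def pderiv2 (a : ℝ → ℝ → ℂ) (β₁ β₂ : ℕ) (x ξ : ℝ) : ℂ :=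
  iteratedDeriv β₁ (fun x' => iteratedDeriv β₂ (fun ξ' => a x' ξ') ξ) x

theorem etaCut_eq (y : ℝ) : etaCut y = Real.smoothTransition (y - 1) := by
  unfold etaCut
  split_ifs with h1 h2
  · rw [Real.smoothTransition.zero_of_nonpos (by linarith)]
  · have e1 : ¬ (y - 1 ≤ 0) := by linarith
    have e2 : ¬ (2 - y ≤ 0) := by linarith
    have e3 : 1 - (y - 1) = 2 - y := by ring
    simp only [Real.smoothTransition, expNegInvGlue, if_neg e1, if_neg e2, e3, one_div]
  · rw [Real.smoothTransition.one_of_one_le (by linarith)]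

/-- Complex-valued version of the cut-off. -/
def etaC (y : ℝ) : ℂ := Complex.ofReal (etaCut y)

theorem etaC_contDiff (k : ℕ∞) : ContDiff ℝ k etaC := by
  have h : ContDiff ℝ k (fun y : ℝ => Real.smoothTransition (y - 1)) :=
    Real.smoothTransition.contDiff.comp (contDiff_id.sub contDiff_const)
  have h2 : etaC = fun y : ℝ => Complex.ofRealCLM (Real.smoothTransition (y - 1)) := by
    funext y
    simp [etaC, etaCut_eq]
  rw [h2]
  exact Complex.ofRealCLM.contDiff.comp h

theorem etaC_deriv_zero (k : ℕ) (y : ℝ) (hy : y < 1) : iteratedDeriv k etaC y = 0 := by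
  have h : etaC =ᶠ[nhds y] fun _ => (0 : ℂ) := by
    filter_upwards [Iio_mem_nhds hy] with z hz
    have hz' : z ≤ 1 := le_of_lt hz
    simp [etaC, etaCut, hz']
  rw [h.iteratedDeriv_eq k, iteratedDeriv_const]
  simp

theorem etaC_bound (k : ℕ) :
    ∃ A : ℝ, 0 ≤ A ∧ ∀ y : ℝ, 1 ≤ y → ‖iteratedDeriv k etaC y‖ * y ^ k ≤ A := by
  have hc : Continuous (fun y : ℝ => ‖iteratedDeriv k etaC y‖ * y ^ k) := by
    have := (etaC_contDiff (k : ℕ∞)).continuous_iteratedDeriv k le_rfl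
    fun_prop
  obtain ⟨B, hB⟩ := (isCompact_Icc (a := (1 : ℝ)) (b := 2)).bddAbove_image hc.continuousOn
  refine ⟨max B 1, le_max_of_le_right zero_le_one, fun y hy => ?_⟩
  rcases le_or_gt y 2 with h2 | h2
  · exact le_max_of_le_left (hB ⟨y, ⟨hy, h2⟩, rfl⟩)
  · have h : etaC =ᶠ[nhds y] fun _ => (1 : ℂ) := by
      filter_upwards [Ioi_mem_nhds h2] with z hz
      have hz0 : (2 : ℝ) < z := hz
      have hz1 : ¬ z ≤ 1 := by linarith
      have hz2 : ¬ z < 2 := by linarith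
      simp [etaC, etaCut, hz1, hz2]
    rw [h.iteratedDeriv_eq k, iteratedDeriv_const]
    apply le_max_of_le_right
    split_ifs with h0
    · simp [h0]
    · simp

theorem etaC_scaled (k : ℕ) (R ξ : ℝ) :
    iteratedDeriv k (fun ξ' => etaC (ξ' / R)) ξ
      = ((R⁻¹ : ℝ) ^ k) • iteratedDeriv k etaC (ξ / R) := by
  have h := congrFun (iteratedDeriv_comp_const_smul (n := k) (etaC_contDiff (k : ℕ∞)) R⁻¹) ξ
  simpa [div_eq_inv_mul] using h

/-- Leibniz formula for the cut-off symbol. -/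
theorem pderiv2_cut (N n : ℕ) (R : ℝ) (a : ℝ → ℝ → ℂ)
    (h1 : ∀ x : ℝ, ContDiff ℝ (n : ℕ∞) (fun ξ => a x ξ))
    (h2 : ∀ β₂ : ℕ, β₂ ≤ n → ∀ ξ : ℝ,
          ContDiff ℝ (N : ℕ∞) (fun x => iteratedDeriv β₂ (fun ξ' => a x ξ') ξ))
    (β₁ : ℕ) (hβ₁ : β₁ ≤ N) (β₂ : ℕ) (hβ₂ : β₂ ≤ n) (x ξ : ℝ) :
    pderiv2 (fun x' ξ' => a x' ξ' * Complex.ofReal (etaCut (ξ' / R))) β₁ β₂ x ξ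
      = ∑ i ∈ Finset.range (β₂ + 1), pderiv2 a β₁ i x ξ *
          ((β₂.choose i : ℂ) * (((R⁻¹ : ℝ) ^ (β₂ - i)) • iteratedDeriv (β₂ - i) etaC (ξ / R))) := by
  have hs : ContDiff ℝ (β₂ : ℕ∞) (fun ξ' : ℝ => etaC (ξ' / R)) :=
    (etaC_contDiff _).comp (contDiff_id.div_const R)
  have key : ∀ x' : ℝ, iteratedDeriv β₂
      (fun ξ' => a x' ξ' * Complex.ofReal (etaCut (ξ' / R))) ξ
      = ∑ i ∈ Finset.range (β₂ + 1), iteratedDeriv i (fun ξ' => a x' ξ') ξ *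
          ((β₂.choose i : ℂ) * (((R⁻¹ : ℝ) ^ (β₂ - i)) • iteratedDeriv (β₂ - i) etaC (ξ / R))) := by
    intro x'
    have ha : ContDiff ℝ (β₂ : ℕ∞) (fun ξ => a x' ξ) := (h1 x').of_le (by exact_mod_cast hβ₂)
    have := iteratedDeriv_fun_mul (n := β₂) (x := ξ) (f := fun ξ' => a x' ξ')
      (g := fun ξ' => etaC (ξ' / R)) ha.contDiffAt hs.contDiffAt
    refine this.trans (Finset.sum_congr rfl fun i _ => ?_)
    rw [etaC_scaled]
    ring
  unfold pderiv2
  simp only [key]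
  rw [iteratedDeriv_fun_sum]
  · refine Finset.sum_congr rfl fun i _ => ?_
    rw [iteratedDeriv_mul_const_field]
  · intro i hi
    have hi' : i ≤ n := by
      have := Finset.mem_range.1 hi
      omega
    have := (h2 i hi' ξ).of_le (m := (β₁ : ℕ∞)) (by exact_mod_cast hβ₁)
    exact (this.mul contDiff_const).contDiffAt

/-- Cutting off a symbol of order `m` by the high-frequency cut-off `η_R(ξ) = η(ξ/R)`
produces a symbol of any higher order `m+ν` whose seminorms gain a factor `R^{-ν}`. -/
theorem cutoff_symbol_estimate (m ν : ℝ) (hν : 0 ≤ ν) (N n : ℕ) :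
    ∃ C : ℝ, 0 < C ∧
      ∀ R : ℝ, 1 ≤ R →
      ∀ a : ℝ → ℝ → ℂ,
        (∀ ξ : ℝ, Function.Periodic (fun x => a x ξ) (2 * Real.pi)) →
        (∀ x : ℝ, ContDiff ℝ (n : ℕ∞) (fun ξ => a x ξ)) →
        (∀ β₂ : ℕ, β₂ ≤ n → ∀ ξ : ℝ,
          ContDiff ℝ (N : ℕ∞) (fun x => iteratedDeriv β₂ (fun ξ' => a x ξ') ξ)) →
        ∀ M : ℝ, 0 < M →
        (∀ β₁ : ℕ, β₁ ≤ N → ∀ β₂ : ℕ, β₂ ≤ n → ∀ x ξ : ℝ,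
          ‖pderiv2 a β₁ β₂ x ξ‖ ≤ M * (max 1 |ξ|) ^ (m - (β₂ : ℝ))) →
        ∀ β₁ : ℕ, β₁ ≤ N → ∀ β₂ : ℕ, β₂ ≤ n → ∀ x ξ : ℝ,
          ‖pderiv2 (fun x' ξ' => a x' ξ' * Complex.ofReal (etaCut (ξ' / R)))
              β₁ β₂ x ξ‖ ≤
            C * M * R ^ (-ν) * (max 1 |ξ|) ^ (m + ν - (β₂ : ℝ)) := by
  choose A hA0 hA using etaC_bound
  set K : ℝ := ∑ k ∈ Finset.range (n + 1), A k with hK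
  have hK0 : 0 ≤ K := Finset.sum_nonneg fun k _ => hA0 k
  have hAK : ∀ k ≤ n, A k ≤ K := fun k hk =>
    Finset.single_le_sum (f := A) (fun k _ => hA0 k) (Finset.mem_range.2 (by omega))
  refine ⟨2 ^ n * (K + 1), by positivity, ?_⟩
  intro R hR a _ h1 h2 M hM hb β₁ hβ₁ β₂ hβ₂ x ξ
  have hR0 : 0 < R := by linarith
  rw [pderiv2_cut N n R a h1 h2 β₁ hβ₁ β₂ hβ₂ x ξ]
  rcases lt_or_ge ξ R with hξ | hξ
  · have hlt : ξ / R < 1 := (div_lt_one hR0).2 hξ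
    simp only [etaC_deriv_zero _ _ hlt, smul_zero, mul_zero, Finset.sum_const_zero, norm_zero]
    positivity
  have hξ0 : 0 < ξ := by linarith
  have hmax : max 1 |ξ| = ξ := by
    rw [abs_of_pos hξ0, max_eq_right (by linarith)]
  have hge : 1 ≤ ξ / R := (one_le_div hR0).2 hξ
  have hterm : ∀ i ∈ Finset.range (β₂ + 1), ‖pderiv2 a β₁ i x ξ *
      ((β₂.choose i : ℂ) * (((R⁻¹ : ℝ) ^ (β₂ - i)) • iteratedDeriv (β₂ - i) etaC (ξ / R)))‖
      ≤ (β₂.choose i : ℝ) * (M * K * ξ ^ (m - (β₂ : ℝ))) := by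
    intro i hi
    have hi' : i ≤ β₂ := by
      have := Finset.mem_range.1 hi
      omega
    have e1 := hb β₁ hβ₁ i (by omega) x ξ
    rw [hmax] at e1
    have e2 := (hA (β₂ - i) (ξ / R) hge).trans (hAK _ (by omega))
    set D := ‖iteratedDeriv (β₂ - i) etaC (ξ / R)‖ with hD
    have hsplit : ξ ^ (m - (i : ℝ)) = ξ ^ (m - (β₂ : ℝ)) * ξ ^ (β₂ - i) := by
      rw [← Real.rpow_natCast, ← Real.rpow_add hξ0, Nat.cast_sub hi']
      congr 1
      ring
    have e3 : ξ ^ (β₂ - i) * ((R⁻¹) ^ (β₂ - i) * D) ≤ K := by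
      refine le_trans (le_of_eq ?_) e2
      rw [div_eq_mul_inv, mul_pow]
      ring
    have hn : ‖pderiv2 a β₁ i x ξ *
        ((β₂.choose i : ℂ) * (((R⁻¹ : ℝ) ^ (β₂ - i)) • iteratedDeriv (β₂ - i) etaC (ξ / R)))‖
        = ‖pderiv2 a β₁ i x ξ‖ * ((β₂.choose i : ℝ) * ((R⁻¹) ^ (β₂ - i) * D)) := by
      rw [norm_mul, norm_mul, norm_smul, Complex.norm_natCast, Real.norm_eq_abs,
        abs_of_nonneg (by positivity)]
    rw [hn]
    calc _ ≤ (M * ξ ^ (m - (i : ℝ))) * ((β₂.choose i : ℝ) * ((R⁻¹) ^ (β₂ - i) * D)) := by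
          gcongr
      _ = (β₂.choose i : ℝ) * (M * ξ ^ (m - (β₂ : ℝ))) *
            (ξ ^ (β₂ - i) * ((R⁻¹) ^ (β₂ - i) * D)) := by
          rw [hsplit]
          ring
      _ ≤ (β₂.choose i : ℝ) * (M * ξ ^ (m - (β₂ : ℝ))) * K := by
          gcongr
      _ = _ := by ring
  have hchoose : ∑ i ∈ Finset.range (β₂ + 1), (β₂.choose i : ℝ) = 2 ^ β₂ := by
    exact_mod_cast Nat.sum_range_choose β₂
  have hpow : (2 : ℝ) ^ β₂ ≤ 2 ^ n := pow_le_pow_right₀ (by norm_num) hβ₂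
  have hgain : 1 ≤ R ^ (-ν) * ξ ^ ν := by
    rw [Real.rpow_neg hR0.le, ← div_eq_inv_mul, ← Real.div_rpow hξ0.le hR0.le]
    exact Real.one_le_rpow hge hν
  have hfin : ξ ^ (m + ν - (β₂ : ℝ)) = ξ ^ (m - (β₂ : ℝ)) * ξ ^ ν := by
    rw [← Real.rpow_add hξ0]
    congr 1
    ring
  rw [hmax, hfin]
  calc _ ≤ ∑ i ∈ Finset.range (β₂ + 1), (β₂.choose i : ℝ) * (M * K * ξ ^ (m - (β₂ : ℝ))) :=
        norm_sum_le_of_le _ hterm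
    _ = 2 ^ β₂ * (M * K * ξ ^ (m - (β₂ : ℝ))) * 1 := by
        rw [← Finset.sum_mul, hchoose, mul_one]
    _ ≤ 2 ^ n * (M * (K + 1) * ξ ^ (m - (β₂ : ℝ))) * (R ^ (-ν) * ξ ^ ν) := by
        gcongr
        linarith
    _ = _ := by ring

end
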